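/- Let {L₁,…,L₆} be a real Schläfli six, i.e., six pairwise skew lines in RP³ lying on a nonsingular cubic surface, and suppose that every 5-element subconfiguration {L₁,…,L₆}∖{Lᵢ} has signature of absolute value 10 (the hexagonal case). Then the configuration {L₁,…,L₆} is coarse deformation equivalent to the join configuration J(123456), i.e., it is deformation equivalent either to J(123456) or to a mirror image of J(123456). -/

import Mathlib

open Submodule

abbrev V4 : Type := Fin 4 → ℝ

abbrev PLine : Type := Submodule ℝ V4

def IsLine (P : PLine) : Prop := Module.finrank ℝ P = 2

def Skew (P Q : PLine) : Prop := IsLine P ∧ IsLine Q ∧ P ⊓ Q = ⊥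

def PairwiseSkew {n : ℕ} (L : Fin n → PLine) : Prop :=
  ∀ i j : Fin n, i ≠ j → Skew (L i) (L j)

noncomputable def det2 (a b c d : V4) : ℝ := Matrix.det (Matrix.of ![a, b, c, d])

open Classical in
noncomputable def lk (P Q R : PLine) : ℝ :=
  if h : ∃ v : Fin 6 → V4,
      P = span ℝ {v 0, v 1} ∧ Q = span ℝ {v 2, v 3} ∧ R = span ℝ {v 4, v 5} then
    Real.sign (det2 (h.choose 0) (h.choose 1) (h.choose 2) (h.choose 3) *
      det2 (h.choose 0) (h.choose 1) (h.choose 4) (h.choose 5) *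
      det2 (h.choose 2) (h.choose 3) (h.choose 4) (h.choose 5))
  else 0

noncomputable def sgnOf {n : ℕ} (L : Fin n → PLine) : ℝ :=
  ∑ i : Fin n, ∑ j : Fin n, ∑ k : Fin n,
    if i < j ∧ j < k then lk (L i) (L j) (L k) else 0

def ContinuousLineFamily (L : ℝ → PLine) : Prop :=
  ∃ v w : ℝ → V4, ContinuousOn v (Set.Icc 0 1) ∧ ContinuousOn w (Set.Icc 0 1) ∧
    ∀ t ∈ Set.Icc (0:ℝ) 1, L t = span ℝ {v t, w t}

def Deformation {n : ℕ} (L L' : Fin n → PLine) : Prop :=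
  ∃ F : ℝ → Fin n → PLine,
    (∀ i, ContinuousLineFamily (fun t => F t i)) ∧
    (∀ t ∈ Set.Icc (0:ℝ) 1, PairwiseSkew (F t)) ∧
    F 0 = L ∧ F 1 = L'

def DeformEquiv {n : ℕ} (L L' : Fin n → PLine) : Prop :=
  ∃ π π' : Equiv.Perm (Fin n), Deformation (L ∘ π) (L' ∘ π')

def IsMirror {n : ℕ} (L L' : Fin n → PLine) : Prop :=
  ∃ A : V4 →ₗ[ℝ] V4, LinearMap.det A < 0 ∧ ∀ i, L' i = (L i).map A

def CoarseDeformEquiv {n : ℕ} (L L' : Fin n → PLine) : Prop :=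
  DeformEquiv L L' ∨ ∃ M : Fin n → PLine, IsMirror L' M ∧ DeformEquiv L M

noncomputable def joinConfig {n : ℕ} (σ : Equiv.Perm (Fin n)) : Fin n → PLine :=
  fun i => span ℝ {![1, (i.val : ℝ) + 1, 0, 0], ![0, 0, ((σ i).val : ℝ) + 1, 1]}

def IsSchlafliSix (L : Fin 6 → PLine) : Prop :=
  PairwiseSkew L ∧
  ∃ F : MvPolynomial (Fin 4) ℝ,
    F ≠ 0 ∧ F.IsHomogeneous 3 ∧
    (∀ i : Fin 6, ∀ x ∈ L i, MvPolynomial.eval x F = 0) ∧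
    (∀ z : Fin 4 → ℂ, z ≠ 0 →
      MvPolynomial.eval z (MvPolynomial.map (algebraMap ℝ ℂ) F) = 0 →
      ∃ j : Fin 4, MvPolynomial.eval z (MvPolynomial.map (algebraMap ℝ ℂ) (MvPolynomial.pderiv j F)) ≠ 0)

def Reducible {n : ℕ} (L : Fin n → PLine) : Prop :=
  ∃ i j : Fin n, i ≠ j ∧ ∃ F : ℝ → Fin n → PLine,
    (∀ k, ContinuousLineFamily (fun t => F t k)) ∧
    F 0 = L ∧
    (∀ t ∈ Set.Ico (0:ℝ) 1, PairwiseSkew (F t)) ∧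
    F 1 i = F 1 j ∧
    (∀ k l : Fin n, k ≠ l → ¬(k = i ∧ l = j) → ¬(k = j ∧ l = i) → Skew (F 1 k) (F 1 l))


section Determinant

lemma det2_eq (a b c d : V4) : det2 a b c d =
    (a 0 * b 1 - a 1 * b 0) * (c 2 * d 3 - c 3 * d 2)
    - (a 0 * b 2 - a 2 * b 0) * (c 1 * d 3 - c 3 * d 1)
    + (a 0 * b 3 - a 3 * b 0) * (c 1 * d 2 - c 2 * d 1)
    + (a 1 * b 2 - a 2 * b 1) * (c 0 * d 3 - c 3 * d 0)
    - (a 1 * b 3 - a 3 * b 1) * (c 0 * d 2 - c 2 * d 0)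
    + (a 2 * b 3 - a 3 * b 2) * (c 0 * d 1 - c 1 * d 0) := by
  simp [det2, Matrix.det_succ_row_zero, Fin.sum_univ_succ, Fin.succAbove]
  ring

lemma det2_comm (a b c d : V4) : det2 c d a b = det2 a b c d := by
  simp only [det2_eq]; ring

lemma det2_swap_left (a b c d : V4) : det2 b a c d = -det2 a b c d := by
  simp only [det2_eq]; ring

lemma det2_combination (a b c d : V4) (α β γ δ : ℝ) :
    det2 (α • a + β • b) (γ • a + δ • b) c d = (α * δ - β * γ) * det2 a b c d := by
  simp only [det2_eq, Pi.add_apply, Pi.smul_apply, smul_eq_mul]; ring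

lemma det2_add_combination (a b c d : V4) (x y u v : ℝ) :
    det2 (a + (x • c + y • d)) (b + (u • c + v • d)) c d = det2 a b c d := by
  simp only [det2_eq, Pi.add_apply, Pi.smul_apply, smul_eq_mul]; ring

lemma det2_mulVec (g : Matrix (Fin 4) (Fin 4) ℝ) (a b c d : V4) :
    det2 (g.mulVec a) (g.mulVec b) (g.mulVec c) (g.mulVec d) = g.det * det2 a b c d := by
  have h : Matrix.of ![g.mulVec a, g.mulVec b, g.mulVec c, g.mulVec d] =
      Matrix.of ![a, b, c, d] * g.transpose := by
    ext i j
    fin_cases i <;> simp [Matrix.mul_apply, Matrix.mulVec, dotProduct, mul_comm]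
  rw [det2, h, Matrix.det_mul, Matrix.det_transpose, mul_comm, det2]

lemma linearIndependent_of_det2_ne_zero {a b c d : V4} (h : det2 a b c d ≠ 0) :
    LinearIndependent ℝ ![a, b, c, d] :=
  Matrix.linearIndependent_rows_of_det_ne_zero h

lemma isLine_span_of_det2_ne_zero {a b c d : V4} (h : det2 a b c d ≠ 0) :
    IsLine (span ℝ {a, b}) := by
  have hi : LinearIndependent ℝ ![a, b] := by
    have := (linearIndependent_of_det2_ne_zero h).comp ![0, 1] (by decide)
    convert this using 1
    ext i j; fin_cases i <;> rfl
  have := finrank_span_eq_card hi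
  rwa [Matrix.range_cons_cons_empty, Fintype.card_fin] at this

lemma skew_span_of_det2_ne_zero {a b c d : V4} (h : det2 a b c d ≠ 0) :
    Skew (span ℝ {a, b}) (span ℝ {c, d}) := by
  refine ⟨isLine_span_of_det2_ne_zero h,
    isLine_span_of_det2_ne_zero (a := c) (b := d) (c := a) (d := b) (by rwa [det2_comm]), ?_⟩
  rw [Submodule.eq_bot_iff]
  rintro x ⟨hx, hx'⟩
  obtain ⟨α, β, rfl⟩ := mem_span_pair.1 hx
  obtain ⟨γ, δ, hγ⟩ := mem_span_pair.1 hx'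
  have hi := Fintype.linearIndependent_iff.1 (linearIndependent_of_det2_ne_zero h)
    ![α, β, -γ, -δ] (by simp [Fin.sum_univ_succ, ← sub_eq_zero.2 hγ.symm]; abel)
  have h0 := hi 0
  have h1 := hi 1
  simp at h0 h1
  simp [h0, h1]

lemma IsLine.exists_span {P : PLine} (h : IsLine P) : ∃ a b : V4, P = span ℝ {a, b} := by
  have : FiniteDimensional ℝ P := inferInstance
  let B := Module.finBasisOfFinrankEq ℝ P h
  refine ⟨B 0, B 1, ?_⟩
  have := congrArg (Submodule.map P.subtype) B.span_eq
  rw [Submodule.map_span, Submodule.map_top, Submodule.range_subtype] at this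
  refine this.symm.trans ?_
  rw [← Set.range_comp]
  congr 1
  ext x
  simp [eq_comm]

lemma det2_ne_zero_of_skew {a b c d : V4} (h : Skew (span ℝ {a, b}) (span ℝ {c, d})) :
    det2 a b c d ≠ 0 := by
  have hi : ∀ {p q : V4}, IsLine (span ℝ {p, q}) → LinearIndependent ℝ ![p, q] := by
    intro p q hpq
    rw [linearIndependent_iff_card_eq_finrank_span, Set.finrank, Matrix.range_cons_cons_empty,
      Fintype.card_fin]
    exact hpq.symm
  intro h0
  obtain ⟨v, hv0, hv⟩ := Matrix.exists_vecMul_eq_zero_iff.2 h0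
  have hv' : v 0 • a + v 1 • b = -v 2 • c + -v 3 • d := by
    ext j
    have := congrFun hv j
    simp [Matrix.vecMul, dotProduct, Fin.sum_univ_succ] at this
    simp
    linarith
  have hz : v 0 • a + v 1 • b = 0 := by
    have : v 0 • a + v 1 • b ∈ span ℝ {a, b} ⊓ span ℝ {c, d} :=
      ⟨mem_span_pair.2 ⟨_, _, rfl⟩, mem_span_pair.2 ⟨_, _, hv'.symm⟩⟩
    rwa [h.2.2, Submodule.mem_bot] at this
  have h1 := LinearIndependent.pair_iff.1 (hi h.1) _ _ hz
  have h2 := LinearIndependent.pair_iff.1 (hi h.2.1) _ _ (hv'.symm.trans hz)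
  apply hv0
  ext i
  fin_cases i
  · exact h1.1
  · exact h1.2
  · exact neg_eq_zero.1 h2.1
  · exact neg_eq_zero.1 h2.2

lemma exists_det2_eq_mul_of_span_eq {a b a' b' : V4} (h : span ℝ {a, b} = span ℝ {a', b'}) :
    ∃ m : ℝ, ∀ c d, det2 a b c d = m * det2 a' b' c d := by
  obtain ⟨α, β, ha⟩ := mem_span_pair.1 (h ▸ mem_span_of_mem (by simp) : a ∈ span ℝ {a', b'})
  obtain ⟨γ, δ, hb⟩ := mem_span_pair.1 (h ▸ mem_span_of_mem (by simp) : b ∈ span ℝ {a', b'})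
  exact ⟨α * δ - β * γ, fun c d => by rw [← ha, ← hb, det2_combination]⟩

lemma lk_span {p p' q q' r r' : V4} (hpq : det2 p p' q q' ≠ 0) (hpr : det2 p p' r r' ≠ 0) :
    lk (span ℝ {p, p'}) (span ℝ {q, q'}) (span ℝ {r, r'}) =
      Real.sign (det2 p p' q q' * det2 p p' r r' * det2 q q' r r') := by
  have hex : ∃ v : Fin 6 → V4, span ℝ {p, p'} = span ℝ {v 0, v 1} ∧
      span ℝ {q, q'} = span ℝ {v 2, v 3} ∧ span ℝ {r, r'} = span ℝ {v 4, v 5} :=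
    ⟨![p, p', q, q', r, r'], rfl, rfl, rfl⟩
  rw [lk, dif_pos hex]
  obtain ⟨h1, h2, h3⟩ := hex.choose_spec
  generalize hex.choose = v at *
  have key : ∀ {a b a' b' c d : V4}, span ℝ {a, b} = span ℝ {a', b'} → det2 a b c d ≠ 0 →
      ∃ m : ℝ, m ≠ 0 ∧ ∀ c d, det2 a' b' c d = m * det2 a b c d := by
    intro a b a' b' c d h h0
    obtain ⟨m, hm⟩ := exists_det2_eq_mul_of_span_eq h
    obtain ⟨m', hm'⟩ := exists_det2_eq_mul_of_span_eq h.symm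
    refine ⟨m', ?_, hm'⟩
    rintro rfl
    apply h0
    rw [hm, hm']
    simp
  obtain ⟨m1, hm1, e1⟩ := key h1 hpq
  obtain ⟨m2, hm2, e2⟩ := key h2 (by rwa [det2_comm] : det2 q q' p p' ≠ 0)
  obtain ⟨m3, hm3, e3⟩ := key h3 (by rwa [det2_comm] : det2 r r' p p' ≠ 0)
  rw [e1, e1, e2, ← det2_comm p p' (v 2), ← det2_comm p p' (v 4), ← det2_comm q q' (v 4), e2, e3,
    e3, det2_comm p p' q, det2_comm p p' r, det2_comm q q' r]
  have : m1 * (m2 * det2 p p' q q') * (m1 * (m3 * det2 p p' r r')) *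
      (m2 * (m3 * det2 q q' r r')) = (m1 * m2 * m3) ^ 2 *
      (det2 p p' q q' * det2 p p' r r' * det2 q q' r r') := by ring
  rw [this]
  have hpos : 0 < (m1 * m2 * m3) ^ 2 := by positivity
  rcases lt_trichotomy (det2 p p' q q' * det2 p p' r r' * det2 q q' r r') 0 with h | h | h
  · rw [Real.sign_of_neg h, Real.sign_of_neg (mul_neg_of_pos_of_neg hpos h)]
  · rw [h, mul_zero]
  · rw [Real.sign_of_pos h, Real.sign_of_pos (mul_pos hpos h)]

lemma abs_lk_le_one (P Q R : PLine) : |lk P Q R| ≤ 1 := by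
  rw [lk]
  split_ifs
  · rcases Real.sign_apply_eq (det2 _ _ _ _ * det2 _ _ _ _ * det2 _ _ _ _) with h | h | h <;>
      rw [h] <;> simp
  · simp

lemma exists_graph_of_skew {P : PLine} {a b c d : V4} (h : Skew P (span ℝ {c, d}))
    (h0 : det2 a b c d ≠ 0) : ∃ x y u v : ℝ,
    P = span ℝ {a + (x • c + y • d), b + (u • c + v • d)} := by
  have hsup : P ⊔ span ℝ {c, d} = ⊤ := by
    apply Submodule.eq_top_of_finrank_eq
    have := Submodule.finrank_sup_add_finrank_inf_eq P (span ℝ {c, d})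
    rw [h.2.2, h.1, h.2.1] at this
    simpa using this
  have key : ∀ e : V4, ∃ x y : ℝ, e + (x • c + y • d) ∈ P := by
    intro e
    obtain ⟨p, hp, m, hm, rfl⟩ := Submodule.mem_sup.1 (hsup ▸ Submodule.mem_top :
      e ∈ P ⊔ span ℝ {c, d})
    obtain ⟨x, y, rfl⟩ := mem_span_pair.1 hm
    exact ⟨-x, -y, by convert hp using 1; module⟩
  obtain ⟨x, y, hx⟩ := key a
  obtain ⟨u, v, hu⟩ := key b
  refine ⟨x, y, u, v, (Submodule.eq_of_le_of_finrank_eq ?_ ?_).symm⟩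
  · rw [span_le]
    rintro e (rfl | rfl)
    exacts [hx, hu]
  · rw [h.1]
    exact isLine_span_of_det2_ne_zero (by rwa [det2_add_combination])

end Determinant

section LinearGroup

open Matrix

lemma exists_diag2n_eq_prod_transvection {n : Type*} [Fintype n] [DecidableEq n] {i j : n} (hij : i ≠ j)
    {c : ℝ} (hc : c ≠ 0) :
    ∃ L : List (TransvectionStruct n ℝ), (SpecialLinearGroup.diag2n hij c hc).1 =
      (L.map TransvectionStruct.toMatrix).prod := by
  refine ⟨[⟨i, j, hij, c⟩, ⟨j, i, hij.symm, -c⁻¹⟩, ⟨i, j, hij, c⟩, ⟨i, j, hij, -1⟩,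
    ⟨j, i, hij.symm, 1⟩, ⟨i, j, hij, -1⟩], ?_⟩
  simp only [List.map_cons, List.map_nil, List.prod_cons, List.prod_nil,
    TransvectionStruct.toMatrix_mk, transvection, SpecialLinearGroup.diag2n_coe]
  simp only [mul_add, add_mul, mul_one, one_mul, single_mul_single_same,
    single_mul_single_of_ne _ _ _ _ hij, single_mul_single_of_ne _ _ _ _ hij.symm, add_zero]
  ext k l
  simp only [diagonal_apply, Matrix.add_apply, one_apply, single_apply]
  by_cases hk : i = k <;> by_cases hl : i = l <;> by_cases hk' : j = k <;> by_cases hl' : j = l <;>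
    simp_all [eq_comm] 

variable {n : Type*} [Fintype n] [DecidableEq n]

lemma joinedIn_det_pos_mul {A B : Matrix n n ℝ} (hA : JoinedIn {g | 0 < g.det} 1 A)
    (hB : JoinedIn {g | 0 < g.det} 1 B) : JoinedIn {g : Matrix n n ℝ | 0 < g.det} 1 (A * B) := by
  have h := hA.mul hB
  rw [one_mul] at h
  refine h.mono ?_
  rintro _ ⟨a, ha, b, hb, rfl⟩
  simpa using mul_pos ha hb

lemma joinedIn_det_pos_transvection {i j : n} (hij : i ≠ j) (c : ℝ) :
    JoinedIn {g : Matrix n n ℝ | 0 < g.det} 1 (transvection i j c) := by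
  refine JoinedIn.ofLine (f := fun t => transvection i j (t * c)) ?_ (by simp) (by simp) ?_
  · refine Continuous.continuousOn (continuous_matrix fun k l => ?_)
    simp only [transvection, Matrix.add_apply, single_apply]
    split_ifs <;> fun_prop
  · rintro _ ⟨t, -, rfl⟩
    simp [det_transvection_of_ne i j hij]

/-- Real matrices of positive determinant form a path-connected set. -/
lemma joinedIn_det_pos [Nontrivial n] {g : Matrix n n ℝ} (hg : 0 < g.det) :
    JoinedIn {g | 0 < g.det} 1 g := by
  have hsl (A : SpecialLinearGroup n ℝ) : JoinedIn {g | 0 < g.det} 1 A.1 := by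
    refine SpecialLinearGroup.diagonal_transvection_induction' (fun A =>
      JoinedIn {g | 0 < g.det} 1 A.1) A (fun i j hij c hc => ?_)
      (fun i j hij a => joinedIn_det_pos_transvection hij a)
      fun A B hA hB => joinedIn_det_pos_mul hA hB
    obtain ⟨L, hL⟩ := exists_diag2n_eq_prod_transvection hij hc
    rw [hL]
    clear hL
    induction L with
    | nil => exact JoinedIn.refl (by simp)
    | cons t L ih =>
      rw [List.map_cons, List.prod_cons]
      exact joinedIn_det_pos_mul (joinedIn_det_pos_transvection t.hij t.c) ih
  set r : ℝ := g.det ^ ((Fintype.card n : ℝ)⁻¹) with hr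
  have hr0 : 0 < r := Real.rpow_pos_of_pos hg _
  have hrn : r ^ Fintype.card n = g.det := Real.rpow_inv_natCast_pow hg.le Fintype.card_ne_zero
  have hs : (r⁻¹ • g).det = 1 := by
    rw [det_smul, inv_pow, hrn, inv_mul_cancel₀ hg.ne']
  refine (hsl ⟨_, hs⟩).trans
    (JoinedIn.ofLine (f := fun t => (1 - t + t * r) • r⁻¹ • g) ?_ (by simp) ?_ ?_)
  · exact Continuous.continuousOn (by fun_prop)
  · simp [smul_smul, hr0.ne']
  · rintro _ ⟨t, ht, rfl⟩
    have : 0 < 1 - t + t * r := by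
      rcases ht.2.lt_or_eq with h | h
      · nlinarith [mul_nonneg ht.1 hr0.le]
      · subst h; simpa
    rw [Set.mem_ofPred_eq, det_smul, hs, mul_one]
    positivity

end LinearGroup

section Frames

variable {n : ℕ}

/-- Families of `n` pairs of vectors that span pairwise skew lines. -/
def skewFrames (n : ℕ) : Set (Fin n → V4 × V4) :=
  {b | ∀ i j, i ≠ j → det2 (b i).1 (b i).2 (b j).1 (b j).2 ≠ 0}

def frameLines (b : Fin n → V4 × V4) (i : Fin n) : PLine := span ℝ {(b i).1, (b i).2}

def frameAct (g : Matrix (Fin 4) (Fin 4) ℝ) (b : Fin n → V4 × V4) (i : Fin n) : V4 × V4 :=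
  (g.mulVec (b i).1, g.mulVec (b i).2)

lemma deformEquiv_of_joinedIn {b b' : Fin n → V4 × V4} (h : JoinedIn (skewFrames n) b b') :
    DeformEquiv (frameLines b) (frameLines b') := by
  refine ⟨1, 1, fun t => frameLines (h.somePath.extend t), fun i => ?_, fun t ht i j hij => ?_,
    by simp, by simp⟩
  · refine ⟨fun t => (h.somePath.extend t i).1, fun t => (h.somePath.extend t i).2,
      Continuous.continuousOn ?_, Continuous.continuousOn ?_, fun t _ => rfl⟩ <;>
    · have := h.somePath.continuous_extend
      fun_prop
  · simp only [Path.extend_apply _ ht]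
    exact skew_span_of_det2_ne_zero (h.somePath_mem ⟨t, ht⟩ i j hij)

lemma frameAct_mem {g : Matrix (Fin 4) (Fin 4) ℝ} (hg : g.det ≠ 0) {b : Fin n → V4 × V4}
    (hb : b ∈ skewFrames n) : frameAct g b ∈ skewFrames n := by
  intro i j hij
  rw [frameAct, frameAct, det2_mulVec]
  exact mul_ne_zero hg (hb i j hij)

lemma JoinedIn.frameAct {g : Matrix (Fin 4) (Fin 4) ℝ} (hg : g.det ≠ 0) {b b' : Fin n → V4 × V4}
    (h : JoinedIn (skewFrames n) b b') :
    JoinedIn (skewFrames n) (frameAct g b) (_root_.frameAct g b') := by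
  refine (h.map (f := _root_.frameAct g) ?_).mono ?_
  · unfold _root_.frameAct
    fun_prop
  · rintro _ ⟨b, hb, rfl⟩
    exact frameAct_mem hg hb

lemma frameAct_one (b : Fin n → V4 × V4) : frameAct 1 b = b := by
  ext i <;> simp [frameAct]

lemma frameAct_mul (g h : Matrix (Fin 4) (Fin 4) ℝ) (b : Fin n → V4 × V4) :
    frameAct (g * h) b = frameAct g (frameAct h b) := by
  ext i <;> simp [frameAct]

lemma joinedIn_frameAct_of_det_pos {g : Matrix (Fin 4) (Fin 4) ℝ} (hg : 0 < g.det)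
    {b : Fin n → V4 × V4} (hb : b ∈ skewFrames n) :
    JoinedIn (skewFrames n) (frameAct g b) b := by
  have h := (joinedIn_det_pos hg).map (f := fun g => frameAct g b)
    (by unfold frameAct; fun_prop)
  simp only [frameAct_one] at h
  refine h.symm.mono ?_
  rintro _ ⟨g, hg, rfl⟩
  exact frameAct_mem (ne_of_gt hg) hb

lemma frameLines_frameAct (g : Matrix (Fin 4) (Fin 4) ℝ) (b : Fin n → V4 × V4) (i : Fin n) :
    frameLines (frameAct g b) i = (frameLines b i).map (Matrix.toLin' g) := by
  simp [frameLines, frameAct, Submodule.map_span, Set.image_pair]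

lemma coarseDeformEquiv_frameAct {g : Matrix (Fin 4) (Fin 4) ℝ} (hg : g.det ≠ 0)
    {b c : Fin n → V4 × V4} (hc : c ∈ skewFrames n)
    (h : JoinedIn (skewFrames n) b (frameAct g c)) :
    CoarseDeformEquiv (frameLines b) (frameLines c) := by
  rcases hg.lt_or_gt with hg | hg
  · exact Or.inr ⟨frameLines (frameAct g c),
      ⟨Matrix.toLin' g, by rwa [LinearMap.det_toLin'], frameLines_frameAct g c⟩,
      deformEquiv_of_joinedIn h⟩
  · exact Or.inl (deformEquiv_of_joinedIn (h.trans (joinedIn_frameAct_of_det_pos hg hc)))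

/-- A real basis of the complex line spanned by `p` in `ℂ² = ℝ⁴`. -/
def complexFrame (p : ℂ × ℂ) : V4 × V4 :=
  (![p.1.re, p.1.im, p.2.re, p.2.im], ![-p.1.im, p.1.re, -p.2.im, p.2.re])

lemma det2_complexFrame (p q : ℂ × ℂ) :
    det2 (complexFrame p).1 (complexFrame p).2 (complexFrame q).1 (complexFrame q).2 =
      Complex.normSq (p.1 * q.2 - q.1 * p.2) := by
  simp [det2_eq, complexFrame, Complex.normSq_apply]
  ring

/-- Any two configurations of distinct complex lines are deformation equivalent. -/
lemma joinedIn_complexFrame {p q : Fin n → ℂ × ℂ}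
    (hp : ∀ i j, i ≠ j → (p i).1 * (p j).2 - (p j).1 * (p i).2 ≠ 0)
    (hq : ∀ i j, i ≠ j → (q i).1 * (q j).2 - (q j).1 * (q i).2 ≠ 0) :
    JoinedIn (skewFrames n) (fun i => complexFrame (p i)) (fun i => complexFrame (q i)) := by
  let P : ℂ → Fin n → ℂ × ℂ := fun s i => p i + s • (q i - p i)
  let w : ℂ → Fin n → Fin n → ℂ := fun s i j => (P s i).1 * (P s j).2 - (P s j).1 * (P s i).2
  let S : Set ℂ := ⋃ i, ⋃ j, {s | i ≠ j ∧ w s i j = 0}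
  have hS : S.Countable := by
    refine Set.countable_iUnion fun i => Set.countable_iUnion fun j => Set.Finite.countable ?_
    by_cases hij : i = j
    · simp [hij]
    let X : Polynomial ℂ := Polynomial.X
    let C : ℂ → Polynomial ℂ := Polynomial.C
    let f : Polynomial ℂ :=
      (C (p i).1 + X * C ((q i).1 - (p i).1)) * (C (p j).2 + X * C ((q j).2 - (p j).2)) -
      (C (p j).1 + X * C ((q j).1 - (p j).1)) * (C (p i).2 + X * C ((q i).2 - (p i).2))
    have hf : ∀ s, f.eval s = w s i j := by
      intro s
      simp [f, w, P, C, X]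
    have hf0 : f ≠ 0 := by
      intro h
      apply hp i j hij
      have := hf 0
      rw [h] at this
      simpa [w, P] using this.symm
    refine (f.rootSet_finite ℂ).subset ?_
    rintro s ⟨-, hs⟩
    rw [Polynomial.mem_rootSet]
    exact ⟨hf0, by rw [Polynomial.coe_aeval_eq_eval, hf, hs]⟩
  have hconn := hS.isPathConnected_compl_of_one_lt_rank
    (by rw [Complex.rank_real_complex]; exact Nat.one_lt_ofNat)
  have h0 : (0 : ℂ) ∈ Sᶜ := by
    simp only [S, Set.mem_compl_iff, Set.mem_iUnion, not_exists]
    rintro i j ⟨hij, h⟩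
    exact hp i j hij (by simpa [w, P] using h)
  have h1 : (1 : ℂ) ∈ Sᶜ := by
    simp only [S, Set.mem_compl_iff, Set.mem_iUnion, not_exists]
    rintro i j ⟨hij, h⟩
    exact hq i j hij (by simpa [w, P] using h)
  have hJ := (hconn.joinedIn _ h0 _ h1).map (f := fun s i => complexFrame (P s i)) (by
    refine continuous_pi fun i => ?_
    unfold complexFrame
    fun_prop)
  simp only [P, zero_smul, add_zero, one_smul, add_sub_cancel] at hJ
  refine hJ.mono ?_
  rintro _ ⟨s, hs, rfl⟩ i j hij
  rw [det2_complexFrame, Ne, Complex.normSq_eq_zero]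
  intro h
  exact hs (Set.mem_iUnion₂.2 ⟨i, j, hij, h⟩)

/-- The pair of vectors spanning the graph of the matrix with columns `(x, y)` and `(u, v)`,
with the identity component scaled by `l`. -/
def graphFrame (l x y u v : ℝ) : V4 × V4 := (![l, 0, x, y], ![0, l, u, v])

lemma det2_graphFrame (l x y u v l' x' y' u' v' : ℝ) :
    det2 (graphFrame l x y u v).1 (graphFrame l x y u v).2
      (graphFrame l' x' y' u' v').1 (graphFrame l' x' y' u' v').2 =
      (l * x' - l' * x) * (l * v' - l' * v) - (l * y' - l' * y) * (l * u' - l' * u) := by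
  simp [det2_eq, graphFrame]
  ring

/-- Graphs with pairwise differences of positive determinant are deformed into complex lines by
scaling the antilinear parts to zero. -/
lemma joinedIn_graphFrame {l x y u v : Fin n → ℝ}
    (h : ∀ i j, i ≠ j → 0 < (l i * x j - l j * x i) * (l i * v j - l j * v i) -
      (l i * y j - l j * y i) * (l i * u j - l j * u i)) :
    ∃ p : Fin n → ℂ × ℂ, (∀ i j, i ≠ j → (p i).1 * (p j).2 - (p j).1 * (p i).2 ≠ 0) ∧
      JoinedIn (skewFrames n) (fun i => graphFrame (l i) (x i) (y i) (u i) (v i))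
        (fun i => complexFrame (p i)) := by
  let G : ℝ → Fin n → V4 × V4 := fun t i => graphFrame (l i)
    ((x i + v i) / 2 + (1 - t) * ((x i - v i) / 2)) ((y i - u i) / 2 + (1 - t) * ((y i + u i) / 2))
    (-((y i - u i) / 2) + (1 - t) * ((y i + u i) / 2))
    ((x i + v i) / 2 - (1 - t) * ((x i - v i) / 2))
  have hG : ∀ t ∈ Set.Icc (0 : ℝ) 1, G t ∈ skewFrames n := by
    intro t ht i j hij
    rw [det2_graphFrame]
    apply ne_of_gt
    have ht' : 0 ≤ 1 - (1 - t) ^ 2 := by nlinarith [ht.1, ht.2]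
    nlinarith [h i j hij,
      mul_nonneg ht' (sq_nonneg ((l i * x j - l j * x i) - (l i * v j - l j * v i))),
      mul_nonneg ht' (sq_nonneg ((l i * y j - l j * y i) + (l i * u j - l j * u i)))]
  let p : Fin n → ℂ × ℂ := fun i => (l i, ⟨(x i + v i) / 2, (y i - u i) / 2⟩)
  have hp : G 1 = fun i => complexFrame (p i) := by
    ext i k <;> fin_cases k <;> simp [G, p, graphFrame, complexFrame]
  refine ⟨p, fun i j hij h0 => ?_, JoinedIn.ofLine (f := G) ?_ ?_ hp ?_⟩
  · have := hG 1 (by simp) i j hij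
    rw [hp, det2_complexFrame, h0] at this
    simp at this
  · apply Continuous.continuousOn
    unfold G graphFrame
    fun_prop
  · ext i k <;> fin_cases k <;> simp [G, graphFrame] <;> ring
  · rintro _ ⟨t, ht, rfl⟩
    exact hG t ht

end Frames

section Signature

lemma lk_eq_of_abs_sgnOf_eq_ten {G : Fin 5 → PLine} (h : |sgnOf G| = 10) :
    ∃ ε : ℝ, ε ≠ 0 ∧ ∀ i j k : Fin 5, i < j → j < k → lk (G i) (G j) (G k) = ε := by
  have hb (i j k : Fin 5) : -1 ≤ lk (G i) (G j) (G k) ∧ lk (G i) (G j) (G k) ≤ 1 :=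
    abs_le.1 (abs_lk_le_one _ _ _)
  have hs : sgnOf G = lk (G 0) (G 1) (G 2) + lk (G 0) (G 1) (G 3) + lk (G 0) (G 1) (G 4) +
      lk (G 0) (G 2) (G 3) + lk (G 0) (G 2) (G 4) + lk (G 0) (G 3) (G 4) +
      lk (G 1) (G 2) (G 3) + lk (G 1) (G 2) (G 4) + lk (G 1) (G 3) (G 4) +
      lk (G 2) (G 3) (G 4) := by
    simp [sgnOf, Fin.sum_univ_five]
    ring
  have h1 := hb 0 1 2
  have h2 := hb 0 1 3
  have h3 := hb 0 1 4
  have h4 := hb 0 2 3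
  have h5 := hb 0 2 4
  have h6 := hb 0 3 4
  have h7 := hb 1 2 3
  have h8 := hb 1 2 4
  have h9 := hb 1 3 4
  have h10 := hb 2 3 4
  rw [hs] at h
  rcases (abs_eq (by norm_num)).1 h with h | h
  · refine ⟨1, by norm_num, fun i j k hij hjk => ?_⟩
    fin_cases i <;> fin_cases j <;> fin_cases k <;> simp at hij hjk ⊢ <;> linarith
  · refine ⟨-1, by norm_num, fun i j k hij hjk => ?_⟩
    fin_cases i <;> fin_cases j <;> fin_cases k <;> simp at hij hjk ⊢ <;> linarith

lemma lk_last_eq_of_abs_sgnOf_eq_ten {L : Fin 6 → PLine}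
    (hsig : ∀ i : Fin 6, |sgnOf (L ∘ i.succAbove)| = 10) :
    ∃ ε : ℝ, ε ≠ 0 ∧ ∀ i j : Fin 6, i < j → j < 5 → lk (L i) (L j) (L 5) = ε := by
  obtain ⟨ε, hε, h4⟩ := lk_eq_of_abs_sgnOf_eq_ten (hsig 4)
  obtain ⟨ε', -, h3⟩ := lk_eq_of_abs_sgnOf_eq_ten (hsig 3)
  obtain ⟨ε'', -, h0⟩ := lk_eq_of_abs_sgnOf_eq_ten (hsig 0)
  have e3 : ε' = ε := (h3 0 1 4 (by decide) (by decide)).symm.trans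
    (h4 0 1 4 (by decide) (by decide))
  have e0 : ε'' = ε := (h0 0 1 4 (by decide) (by decide)).symm.trans
    (h4 1 2 4 (by decide) (by decide))
  subst e3 e0
  refine ⟨_, hε, fun i j hij hj => ?_⟩
  fin_cases j <;> fin_cases i <;> simp at hij hj
  · exact h4 0 1 4 (by decide) (by decide)
  · exact h4 0 2 4 (by decide) (by decide)
  · exact h4 1 2 4 (by decide) (by decide)
  · exact h4 0 3 4 (by decide) (by decide)
  · exact h4 1 3 4 (by decide) (by decide)
  · exact h4 2 3 4 (by decide) (by decide)
  · exact h3 0 3 4 (by decide) (by decide)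
  · exact h3 1 3 4 (by decide) (by decide)
  · exact h3 2 3 4 (by decide) (by decide)
  · exact h0 2 3 4 (by decide) (by decide)

/-- If all triple linking indices involving the line `k` agree, the configuration consists of
graphs whose pairwise differences have positive determinant. -/
lemma exists_frameAct_graphFrame {n : ℕ} {L : Fin n → PLine} (hL : PairwiseSkew L) {i₀ k : Fin n}
    (hi₀ : i₀ ≠ k) {ε : ℝ} (hε : ε ≠ 0)
    (hlk : ∀ i j, i < j → i ≠ k → j ≠ k → lk (L i) (L j) (L k) = ε) :
    ∃ g : Matrix (Fin 4) (Fin 4) ℝ, g.det ≠ 0 ∧ ∃ l x y u v : Fin n → ℝ,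
      L = frameLines (frameAct g fun i => graphFrame (l i) (x i) (y i) (u i) (v i)) ∧
      ∀ i j, i ≠ j → 0 < (l i * x j - l j * x i) * (l i * v j - l j * v i) -
        (l i * y j - l j * y i) * (l i * u j - l j * u i) := by
  obtain ⟨c, d, hcd⟩ := (hL k i₀ hi₀.symm).1.exists_span
  obtain ⟨a₀, b₀, hab₀⟩ := (hL i₀ k hi₀).1.exists_span
  have h₀ : det2 a₀ b₀ c d ≠ 0 := det2_ne_zero_of_skew (hab₀ ▸ hcd ▸ hL i₀ k hi₀)
  obtain ⟨a, b, hab⟩ : ∃ a b, 0 < ε * det2 a b c d := by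
    rcases (mul_ne_zero hε h₀).lt_or_gt with h | h
    · exact ⟨b₀, a₀, by rw [det2_swap_left]; linarith⟩
    · exact ⟨a₀, b₀, h⟩
  have hΔ : det2 a b c d ≠ 0 := fun h => by simp [h] at hab
  let g : Matrix (Fin 4) (Fin 4) ℝ := (Matrix.of ![a, b, c, d]).transpose
  have hg : g.det = det2 a b c d := Matrix.det_transpose _
  have hgv (p q r s : ℝ) : g.mulVec ![p, q, r, s] = p • a + q • b + (r • c + s • d) := by
    ext m
    simp [g, Matrix.mulVec, dotProduct, Fin.sum_univ_succ]
    ring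
  have hex (i : Fin n) : ∃ l x y u v : ℝ,
      L i = span ℝ {g.mulVec (graphFrame l x y u v).1, g.mulVec (graphFrame l x y u v).2} ∧
      (i ≠ k → l = 1) ∧ (i = k → l = 0 ∧ x = 1 ∧ y = 0 ∧ u = 0 ∧ v = 1) := by
    by_cases hi : i = k
    · refine ⟨0, 1, 0, 0, 1, ?_, fun h => (h hi).elim, fun _ => by simp⟩
      rw [hi, hcd, graphFrame, hgv, hgv]
      simp
    · obtain ⟨x, y, u, v, h⟩ := exists_graph_of_skew (hcd ▸ hL i k hi) hΔ
      refine ⟨1, x, y, u, v, ?_, fun _ => rfl, fun h => (hi h).elim⟩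
      rw [h, graphFrame, hgv, hgv]
      simp
  choose l x y u v hspan h1 h0 using hex
  refine ⟨g, hg ▸ hΔ, l, x, y, u, v, funext hspan, ?_⟩
  have hsign (X : ℝ) (hX : Real.sign X = ε) : 0 < ε * X :=
    hX ▸ Real.sign_mul_pos_of_ne_zero X (by rintro rfl; exact hε (by simpa using hX.symm))
  have hlt : ∀ i j, i < j → i ≠ k → j ≠ k →
      0 < (l i * x j - l j * x i) * (l i * v j - l j * v i) -
        (l i * y j - l j * y i) * (l i * u j - l j * u i) := by
    intro i j hij hi hj
    have hdet : ∀ i j, det2 (g.mulVec (graphFrame (l i) (x i) (y i) (u i) (v i)).1)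
        (g.mulVec (graphFrame (l i) (x i) (y i) (u i) (v i)).2)
        (g.mulVec (graphFrame (l j) (x j) (y j) (u j) (v j)).1)
        (g.mulVec (graphFrame (l j) (x j) (y j) (u j) (v j)).2) = det2 a b c d *
        ((l i * x j - l j * x i) * (l i * v j - l j * v i) -
        (l i * y j - l j * y i) * (l i * u j - l j * u i)) := fun i j => by
      rw [det2_mulVec, det2_graphFrame, hg]
    have hne : ∀ i j, i ≠ j → det2 (g.mulVec (graphFrame (l i) (x i) (y i) (u i) (v i)).1)
        (g.mulVec (graphFrame (l i) (x i) (y i) (u i) (v i)).2)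
        (g.mulVec (graphFrame (l j) (x j) (y j) (u j) (v j)).1)
        (g.mulVec (graphFrame (l j) (x j) (y j) (u j) (v j)).2) ≠ 0 := fun i j hij => by
      have h := hL i j hij
      rw [hspan i, hspan j] at h
      exact det2_ne_zero_of_skew h
    have hk := hlk i j hij hi hj
    rw [hspan i, hspan j, hspan k, lk_span (hne i j hij.ne) (hne i k hi), hdet, hdet, hdet,
      h1 i hi, h1 j hj] at hk
    obtain ⟨e1, e2, e3, e4, e5⟩ := h0 k rfl
    rw [e1, e2, e3, e4, e5] at hk
    rw [h1 i hi, h1 j hj]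
    have hpos : 0 < ε * det2 a b c d * det2 a b c d ^ 2 := by positivity
    refine pos_of_mul_pos_right (lt_of_lt_of_eq (hsign _ hk) ?_) hpos.le
    ring
  intro i j hij
  by_cases hi : i = k
  · obtain ⟨e1, e2, e3, e4, e5⟩ := h0 i hi
    rw [e1, e2, e3, e4, e5, h1 j (hi ▸ hij.symm)]
    norm_num
  by_cases hj : j = k
  · obtain ⟨e1, e2, e3, e4, e5⟩ := h0 j hj
    rw [e1, e2, e3, e4, e5, h1 i hi]
    norm_num
  rcases hij.lt_or_gt with h | h
  · exact hlt i j h hi hj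
  · have := hlt j i h hj hi
    nlinarith

end Signature

section Join

lemma joinConfig_refl_eq (n : ℕ) : ∃ K : Matrix (Fin 4) (Fin 4) ℝ, K.det ≠ 0 ∧
    joinConfig (Equiv.refl (Fin n)) =
      frameLines (frameAct K fun i => complexFrame (1, ((i.val : ℂ) + 1))) := by
  refine ⟨!![1, 0, 0, 0; 0, 0, 1, 0; 0, 0, 0, 1; 0, 1, 0, 0], ?_, ?_⟩
  · simp [Matrix.det_succ_row_zero, Fin.sum_univ_succ, Fin.succAbove]
  · funext i
    have h : ∀ p : V4, (!![1, 0, 0, 0; 0, 0, 1, 0; 0, 0, 0, 1; 0, 1, 0, 0] :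
        Matrix (Fin 4) (Fin 4) ℝ).mulVec p = ![p 0, p 2, p 3, p 1] := by
      intro p
      ext j
      fin_cases j <;> simp [Matrix.mulVec, dotProduct, Fin.sum_univ_succ]
    simp [joinConfig, frameLines, frameAct, complexFrame, h, -Matrix.mulVec_cons]

lemma complexFrame_mem_skewFrames {n : ℕ} {p : Fin n → ℂ × ℂ}
    (hp : ∀ i j, i ≠ j → (p i).1 * (p j).2 - (p j).1 * (p i).2 ≠ 0) :
    (fun i => complexFrame (p i)) ∈ skewFrames n := by
  intro i j hij
  rw [det2_complexFrame, Ne, Complex.normSq_eq_zero]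
  exact hp i j hij

/-- Pairwise skew lines whose triple linking indices with a fixed line all agree form, up to
deformation and mirror reflection, the identity join configuration. -/
lemma coarseDeformEquiv_joinConfig_refl {n : ℕ} {L : Fin n → PLine} (hL : PairwiseSkew L)
    {i₀ k : Fin n} (hi₀ : i₀ ≠ k) {ε : ℝ} (hε : ε ≠ 0)
    (hlk : ∀ i j, i < j → i ≠ k → j ≠ k → lk (L i) (L j) (L k) = ε) :
    CoarseDeformEquiv L (joinConfig (Equiv.refl (Fin n))) := by
  obtain ⟨g, hg, l, x, y, u, v, rfl, hpos⟩ := exists_frameAct_graphFrame hL hi₀ hε hlk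
  obtain ⟨p, hp, hJ⟩ := joinedIn_graphFrame hpos
  obtain ⟨K, hK, hKJ⟩ := joinConfig_refl_eq n
  have hq : ∀ i j : Fin n, i ≠ j → (1 : ℂ) * ((j.val : ℂ) + 1) - 1 * ((i.val : ℂ) + 1) ≠ 0 := by
    intro i j hij h
    apply hij
    have : (j.val : ℂ) = i.val := by linear_combination h
    exact Fin.ext (Nat.cast_injective this).symm
  have hJ' := (hJ.trans (joinedIn_complexFrame hp
    (q := fun i => (1, ((i.val : ℂ) + 1))) hq)).frameAct hg
  rw [hKJ]
  refine coarseDeformEquiv_frameAct (g := g * K⁻¹) ?_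
    (frameAct_mem hK (complexFrame_mem_skewFrames hq)) ?_
  · rw [Matrix.det_mul]
    exact mul_ne_zero hg (Matrix.det_nonsing_inv K ▸ by simpa using hK)
  · rwa [← frameAct_mul, Matrix.mul_assoc, Matrix.nonsing_inv_mul K (isUnit_iff_ne_zero.2 hK),
      Matrix.mul_one]

end Join

theorem schlafli_hexagonal_coarse_J123456 (L : Fin 6 → PLine) (hL : IsSchlafliSix L)
    (hsig : ∀ i : Fin 6, |sgnOf (L ∘ i.succAbove)| = 10) :
    CoarseDeformEquiv L (joinConfig (Equiv.refl (Fin 6))) := by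
  obtain ⟨ε, hε, hlk⟩ := lk_last_eq_of_abs_sgnOf_eq_ten hsig
  exact coarseDeformEquiv_joinConfig_refl hL.1 (i₀ := 0) (k := 5) (by decide) hε
    fun i j hij _ hj => hlk i j hij (by omega)
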